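/- Suppose the matrix A together with γ̄ satisfies Assumption 2 and X(t) is generated by the algorithm X(t+1) = P_{γ̄}(A X(t)). On the (open) set of initial states X₀ ∈ S(n,d,γ̄) for which asymptotic consensus of directions with point-wise convergence occurs, the consensus direction u(X₀) ∈ S^{d-1} (the common limit of the normalized rows x_i(t)/‖x_i(t)‖₂) is a continuous function of X₀; it equals v(X₀)X₀/‖v(X₀)X₀‖₂ where v(X₀) is the strictly positive unit vector to which all Euclidean-normalized rows of the product matrices Ã(k,t₀,X₀) converge. -/

import Mathlib

open Finset Filter Topology Matrix

noncomputable def euclNorm {d : ℕ} (x : Fin d → ℝ) : ℝ := Real.sqrt (∑ j, x j ^ 2)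

def unitSphere (d : ℕ) : Set (Fin d → ℝ) := {x | euclNorm x = 1}

/-- A directional function on `S^{d-1}`: continuous and bounded above and below
by positive constants on the unit sphere. -/
def IsDirectional {d : ℕ} (γ : (Fin d → ℝ) → ℝ) : Prop :=
  ContinuousOn γ (unitSphere d) ∧
    ∃ c C : ℝ, 0 < c ∧ ∀ x ∈ unitSphere d, c ≤ γ x ∧ γ x ≤ C

/-- The star boundary `S^{d-1}_γ = {γ(x) x : x ∈ S^{d-1}}`. -/
def starBoundary {d : ℕ} (γ : (Fin d → ℝ) → ℝ) : Set (Fin d → ℝ) :=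
  {y | ∃ x ∈ unitSphere d, y = γ x • x}

/-- `S(n,d,γ̄)`: matrices whose `i`-th row lies on the star boundary of `γ_i`. -/
def Sset (n d : ℕ) (γbar : Fin n → (Fin d → ℝ) → ℝ) : Set (Matrix (Fin n) (Fin d) ℝ) :=
  {X | ∀ i, X i ∈ starBoundary (γbar i)}

/-- Radial projection `P_γ(y) = γ(y/‖y‖₂) · y/‖y‖₂`. -/
noncomputable def radialProj {d : ℕ} (γ : (Fin d → ℝ) → ℝ) (y : Fin d → ℝ) : Fin d → ℝ :=
  γ ((euclNorm y)⁻¹ • y) • ((euclNorm y)⁻¹ • y)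

/-- Row-wise radial projection. -/
noncomputable def rowProj {n d : ℕ} (γbar : Fin n → (Fin d → ℝ) → ℝ)
    (B : Matrix (Fin n) (Fin d) ℝ) : Matrix (Fin n) (Fin d) ℝ :=
  Matrix.of fun i => radialProj (γbar i) (B i)

/-- Assumption 2: each `γ_i` is directional, `A` is a nonnegative weight matrix of a strongly
connected digraph, and the diagonal-dominance condition
`a_ii · min γ_i > Σ_{j≠i} a_ij · max γ_j` holds. -/
def Assumption2 {n d : ℕ} (A : Matrix (Fin n) (Fin n) ℝ)
    (γbar : Fin n → (Fin d → ℝ) → ℝ) : Prop :=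
  (∀ i, IsDirectional (γbar i)) ∧
  (∃ E : Fin n → Fin n → Prop,
    (∀ i j, E i j → 0 < A i j) ∧ (∀ i j, ¬ E i j → A i j = 0) ∧
    (∀ i j, Relation.ReflTransGen E i j)) ∧
  (∀ i, (∑ j ∈ Finset.univ.erase i, A i j * sSup (γbar j '' unitSphere d)) <
      A i i * sInf (γbar i '' unitSphere d))

/-- The trajectory of the algorithm `X(t+1) = P_γ̄(A X(t))`, indexed by `k = t - t₀`. -/
noncomputable def traj {n d : ℕ} (A : Matrix (Fin n) (Fin n) ℝ)
    (γbar : Fin n → (Fin d → ℝ) → ℝ) (X₀ : Matrix (Fin n) (Fin d) ℝ) :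
    ℕ → Matrix (Fin n) (Fin d) ℝ
  | 0 => X₀
  | k + 1 => rowProj γbar (A * traj A γbar X₀ k)

/-- `D_γ̄(B)`: diagonal matrix with entries `γ_i([B]_i/‖[B]_i‖₂)/‖[B]_i‖₂`. -/
noncomputable def Dmat {n d : ℕ} (γbar : Fin n → (Fin d → ℝ) → ℝ)
    (B : Matrix (Fin n) (Fin d) ℝ) : Matrix (Fin n) (Fin n) ℝ :=
  Matrix.diagonal fun i => γbar i ((euclNorm (B i))⁻¹ • B i) / euclNorm (B i)

/-- The product matrices `Ã(k,t₀,X₀) = D_γ̄(A X(t₀+k−1))A ⋯ D_γ̄(A X(t₀))A`. -/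
noncomputable def Atilde {n d : ℕ} (A : Matrix (Fin n) (Fin n) ℝ)
    (γbar : Fin n → (Fin d → ℝ) → ℝ) (X₀ : Matrix (Fin n) (Fin d) ℝ) :
    ℕ → Matrix (Fin n) (Fin n) ℝ
  | 0 => 1
  | k + 1 => Dmat γbar (A * traj A γbar X₀ k) * A * Atilde A γbar X₀ k

/-- `v` is the strictly positive unit vector to which all Euclidean-normalized rows of
`Ã(k,t₀,X₀)` converge. -/
def IsLimitVec {n d : ℕ} (A : Matrix (Fin n) (Fin n) ℝ)
    (γbar : Fin n → (Fin d → ℝ) → ℝ) (X₀ : Matrix (Fin n) (Fin d) ℝ)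
    (v : Fin n → ℝ) : Prop :=
  euclNorm v = 1 ∧ (∀ i, 0 < v i) ∧
    ∀ i, Tendsto (fun k => (euclNorm (Atilde A γbar X₀ k i))⁻¹ • Atilde A γbar X₀ k i)
      atTop (𝓝 v)

/-- Asymptotic consensus of directions. -/
def ConsensusDir {n d : ℕ} (X : ℕ → Matrix (Fin n) (Fin d) ℝ) : Prop :=
  ∀ i j, Tendsto
    (fun t => euclNorm ((euclNorm (X t i))⁻¹ • X t i - (euclNorm (X t j))⁻¹ • X t j))
    atTop (𝓝 0)

/-- Asymptotic consensus of directions with point-wise convergence to a unit vector. -/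
def ConsensusPW {n d : ℕ} (X : ℕ → Matrix (Fin n) (Fin d) ℝ) : Prop :=
  ∃ u : Fin d → ℝ, euclNorm u = 1 ∧
    ∀ i, Tendsto (fun t => (euclNorm (X t i))⁻¹ • X t i) atTop (𝓝 u)

section EuclideanNorm

variable {d : ℕ}

theorem euclNorm_eq_norm (x : Fin d → ℝ) : euclNorm x = ‖WithLp.toLp 2 x‖ := by
  simp [euclNorm, EuclideanSpace.norm_eq]

theorem euclNorm_nonneg (x : Fin d → ℝ) : 0 ≤ euclNorm x := Real.sqrt_nonneg _

theorem euclNorm_zero : euclNorm (0 : Fin d → ℝ) = 0 := by simp [euclNorm]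

theorem euclNorm_eq_zero {x : Fin d → ℝ} : euclNorm x = 0 ↔ x = 0 := by
  rw [euclNorm_eq_norm, norm_eq_zero, WithLp.toLp_eq_zero]

theorem euclNorm_pos {x : Fin d → ℝ} : 0 < euclNorm x ↔ x ≠ 0 := by
  rw [(euclNorm_nonneg x).lt_iff_ne, ne_comm, Ne, euclNorm_eq_zero]

theorem euclNorm_smul (c : ℝ) (x : Fin d → ℝ) : euclNorm (c • x) = |c| * euclNorm x := by
  simp [euclNorm_eq_norm, WithLp.toLp_smul, norm_smul]

theorem euclNorm_neg (x : Fin d → ℝ) : euclNorm (-x) = euclNorm x := by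
  simp [euclNorm]

theorem euclNorm_sum_le {ι : Type*} (s : Finset ι) (f : ι → Fin d → ℝ) :
    euclNorm (∑ i ∈ s, f i) ≤ ∑ i ∈ s, euclNorm (f i) := by
  simpa [euclNorm_eq_norm, WithLp.toLp_sum] using norm_sum_le s fun i => WithLp.toLp 2 (f i)

theorem continuous_euclNorm : Continuous (euclNorm : (Fin d → ℝ) → ℝ) := by
  unfold euclNorm
  fun_prop

theorem dotProduct_self_eq_euclNorm_sq (x : Fin d → ℝ) : x ⬝ᵥ x = euclNorm x ^ 2 := by
  rw [euclNorm, Real.sq_sqrt (Finset.sum_nonneg fun j _ => sq_nonneg _)]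
  simp [dotProduct, sq]

theorem euclNorm_inv_smul_self {x : Fin d → ℝ} (hx : x ≠ 0) :
    euclNorm ((euclNorm x)⁻¹ • x) = 1 := by
  have h := euclNorm_pos.2 hx
  rw [euclNorm_smul, abs_of_pos (inv_pos.2 h), inv_mul_cancel₀ h.ne']

theorem continuousAt_euclNorm_inv_smul {x : Fin d → ℝ} (hx : x ≠ 0) :
    ContinuousAt (fun y : Fin d → ℝ => (euclNorm y)⁻¹ • y) x :=
  (continuous_euclNorm.continuousAt.inv₀ (euclNorm_pos.2 hx).ne').smul continuousAt_id

/-- Positive rescaling does not change the direction. -/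
theorem euclNorm_inv_smul_smul {c : ℝ} (hc : 0 < c) (x : Fin d → ℝ) :
    (euclNorm (c • x))⁻¹ • (c • x) = (euclNorm x)⁻¹ • x := by
  rw [euclNorm_smul, abs_of_pos hc, smul_smul, mul_inv, mul_right_comm, inv_mul_cancel₀ hc.ne',
    one_mul]

/-- Unit vectors whose inner product with a unit vector `u` tends to `1` converge to `u`. -/
theorem tendsto_of_tendsto_dotProduct_one {α : Type*} {l : Filter α} {f : α → Fin d → ℝ}
    {u : Fin d → ℝ} (hu : euclNorm u = 1) (hf : ∀ᶠ a in l, euclNorm (f a) = 1)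
    (h : ∀ c < 1, ∀ᶠ a in l, c ≤ f a ⬝ᵥ u) : Tendsto f l (𝓝 u) := by
  rw [tendsto_pi_nhds]
  intro j
  rw [Metric.tendsto_nhds]
  intro ε hε
  filter_upwards [hf, h (1 - ε ^ 2 / 4) (by nlinarith [sq_pos_of_pos hε])] with a ha hc
  rw [Real.dist_eq]
  have hsq : (f a - u) ⬝ᵥ (f a - u) = 2 - 2 * (f a ⬝ᵥ u) := by
    have h1 := dotProduct_self_eq_euclNorm_sq (f a)
    have h2 := dotProduct_self_eq_euclNorm_sq u
    rw [ha] at h1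
    rw [hu] at h2
    simp only [sub_dotProduct, dotProduct_sub, h1, h2, dotProduct_comm u (f a)]
    ring
  have hj : (f a j - u j) * (f a j - u j) ≤ (f a - u) ⬝ᵥ (f a - u) :=
    Finset.single_le_sum (f := fun j => (f a - u) j * (f a - u) j)
      (fun i _ => mul_self_nonneg _) (Finset.mem_univ j)
  refine abs_lt_of_sq_lt_sq ?_ hε.le
  nlinarith [sq_pos_of_pos hε]

end EuclideanNorm

section Dynamics

variable {n d : ℕ} {A : Matrix (Fin n) (Fin n) ℝ} {γbar : Fin n → (Fin d → ℝ) → ℝ}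

theorem IsDirectional.pos {γ : (Fin d → ℝ) → ℝ} (h : IsDirectional γ) {x : Fin d → ℝ}
    (hx : x ∈ unitSphere d) : 0 < γ x := by
  obtain ⟨-, c, C, hc, hb⟩ := h
  exact hc.trans_le (hb x hx).1

theorem IsDirectional.sInf_le_euclNorm {γ : (Fin d → ℝ) → ℝ} (h : IsDirectional γ)
    {y : Fin d → ℝ} (hy : y ∈ starBoundary γ) : sInf (γ '' unitSphere d) ≤ euclNorm y := by
  obtain ⟨x, hx, rfl⟩ := hy
  rw [euclNorm_smul, abs_of_pos (h.pos hx), show euclNorm x = 1 from hx, mul_one]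
  exact csInf_le ⟨0, by rintro _ ⟨z, hz, rfl⟩; exact (h.pos hz).le⟩ ⟨x, hx, rfl⟩

theorem IsDirectional.euclNorm_le_sSup {γ : (Fin d → ℝ) → ℝ} (h : IsDirectional γ)
    {y : Fin d → ℝ} (hy : y ∈ starBoundary γ) : euclNorm y ≤ sSup (γ '' unitSphere d) := by
  obtain ⟨x, hx, rfl⟩ := hy
  rw [euclNorm_smul, abs_of_pos (h.pos hx), show euclNorm x = 1 from hx, mul_one]
  obtain ⟨-, c, C, hc, hb⟩ := h
  exact le_csSup ⟨C, by rintro _ ⟨z, hz, rfl⟩; exact (hb z hz).2⟩ ⟨x, hx, rfl⟩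

theorem IsDirectional.ne_zero {γ : (Fin d → ℝ) → ℝ} (h : IsDirectional γ)
    {y : Fin d → ℝ} (hy : y ∈ starBoundary γ) : y ≠ 0 := by
  obtain ⟨x, hx, rfl⟩ := hy
  refine smul_ne_zero (h.pos hx).ne' ?_
  rintro rfl
  exact zero_ne_one (euclNorm_zero.symm.trans hx)

theorem Assumption2.nonneg (hA : Assumption2 A γbar) (i j : Fin n) : 0 ≤ A i j := by
  obtain ⟨-, ⟨E, h1, h2, -⟩, -⟩ := hA
  by_cases h : E i j
  · exact (h1 i j h).le
  · exact (h2 i j h).ge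

theorem mul_row_eq_sum (B : Matrix (Fin n) (Fin n) ℝ) (X : Matrix (Fin n) (Fin d) ℝ)
    (i : Fin n) : (B * X) i = ∑ j, B i j • X j := by
  ext l
  simp [Matrix.mul_apply]

theorem mul_row_eq_vecMul (B : Matrix (Fin n) (Fin n) ℝ) (X : Matrix (Fin n) (Fin d) ℝ)
    (i : Fin n) : (B * X) i = Matrix.vecMul (B i) X := by
  ext l
  simp [Matrix.mul_apply, Matrix.vecMul, dotProduct]

/-- Diagonal dominance keeps the rows of `A X` away from zero. -/
theorem Assumption2.mul_row_ne_zero (hA : Assumption2 A γbar) {X : Matrix (Fin n) (Fin d) ℝ}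
    (hX : X ∈ Sset n d γbar) (i : Fin n) : (A * X) i ≠ 0 := by
  intro h0
  rw [mul_row_eq_sum, ← Finset.add_sum_erase _ _ (Finset.mem_univ i)] at h0
  have h1 : euclNorm (A i i • X i) ≤
      ∑ j ∈ Finset.univ.erase i, A i j * sSup (γbar j '' unitSphere d) := by
    rw [eq_neg_of_add_eq_zero_left h0, euclNorm_neg]
    refine (euclNorm_sum_le _ _).trans (Finset.sum_le_sum fun j _ => ?_)
    rw [euclNorm_smul, abs_of_nonneg (hA.nonneg i j)]
    exact mul_le_mul_of_nonneg_left ((hA.1 j).euclNorm_le_sSup (hX j)) (hA.nonneg i j)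
  rw [euclNorm_smul, abs_of_nonneg (hA.nonneg i i)] at h1
  have h2 := mul_le_mul_of_nonneg_left ((hA.1 i).sInf_le_euclNorm (hX i)) (hA.nonneg i i)
  linarith [hA.2.2 i]

theorem Assumption2.traj_mem (hA : Assumption2 A γbar) {X : Matrix (Fin n) (Fin d) ℝ}
    (hX : X ∈ Sset n d γbar) (k : ℕ) : traj A γbar X k ∈ Sset n d γbar := by
  induction k with
  | zero => exact hX
  | succ k ih =>
    intro i
    exact ⟨_, euclNorm_inv_smul_self (hA.mul_row_ne_zero ih i), rfl⟩

theorem Assumption2.traj_ne_zero (hA : Assumption2 A γbar) {X : Matrix (Fin n) (Fin d) ℝ}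
    (hX : X ∈ Sset n d γbar) (k : ℕ) (i : Fin n) : traj A γbar X k i ≠ 0 :=
  (hA.1 i).ne_zero (hA.traj_mem hX k i)

theorem rowProj_eq_Dmat_mul (B : Matrix (Fin n) (Fin d) ℝ) :
    rowProj γbar B = Dmat γbar B * B := by
  ext i l
  simp [rowProj, radialProj, Dmat, Matrix.diagonal_mul]
  ring

theorem traj_eq_Atilde_mul (X : Matrix (Fin n) (Fin d) ℝ) (k : ℕ) :
    traj A γbar X k = Atilde A γbar X k * X := by
  induction k with
  | zero => simp [traj, Atilde]
  | succ k ih =>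
    rw [traj, rowProj_eq_Dmat_mul, Atilde, Matrix.mul_assoc, Matrix.mul_assoc, ← ih]

/-- The `i`-th diagonal entry of `D_γ̄(A X(k))`. -/
noncomputable def stepScale (A : Matrix (Fin n) (Fin n) ℝ) (γbar : Fin n → (Fin d → ℝ) → ℝ)
    (X : Matrix (Fin n) (Fin d) ℝ) (k : ℕ) (i : Fin n) : ℝ :=
  γbar i ((euclNorm ((A * traj A γbar X k) i))⁻¹ • (A * traj A γbar X k) i) /
    euclNorm ((A * traj A γbar X k) i)

theorem Assumption2.stepScale_pos (hA : Assumption2 A γbar) {X : Matrix (Fin n) (Fin d) ℝ}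
    (hX : X ∈ Sset n d γbar) (k : ℕ) (i : Fin n) : 0 < stepScale A γbar X k i := by
  have h := hA.mul_row_ne_zero (hA.traj_mem hX k) i
  exact div_pos ((hA.1 i).pos (euclNorm_inv_smul_self h)) (euclNorm_pos.2 h)

theorem traj_succ_row (X : Matrix (Fin n) (Fin d) ℝ) (k : ℕ) (i : Fin n) :
    traj A γbar X (k + 1) i = stepScale A γbar X k i • ∑ j, A i j • traj A γbar X k j := by
  rw [← mul_row_eq_sum, traj, rowProj_eq_Dmat_mul]
  ext l
  simp [Dmat, stepScale, Matrix.diagonal_mul]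

theorem Atilde_succ_apply (X : Matrix (Fin n) (Fin d) ℝ) (k : ℕ) (i j : Fin n) :
    Atilde A γbar X (k + 1) i j =
      stepScale A γbar X k i * ∑ l, A i l * Atilde A γbar X k l j := by
  rw [Atilde, Dmat, Matrix.mul_assoc, Matrix.diagonal_mul, Matrix.mul_apply]
  rfl

theorem Assumption2.continuousOn_traj (hA : Assumption2 A γbar) (k : ℕ) :
    ContinuousOn (fun X => traj A γbar X k) (Sset n d γbar) := by
  induction k with
  | zero => exact continuousOn_id
  | succ k ih =>
    refine continuousOn_pi.2 fun i => ?_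
    have hrow : ContinuousOn (fun X => (A * traj A γbar X k) i) (Sset n d γbar) :=
      (continuous_apply i).comp_continuousOn
        ((continuous_const.matrix_mul continuous_id).comp_continuousOn ih)
    have hdir : ContinuousOn
        (fun X => (euclNorm ((A * traj A γbar X k) i))⁻¹ • (A * traj A γbar X k) i)
        (Sset n d γbar) := fun X hX =>
      (continuousAt_euclNorm_inv_smul
        (hA.mul_row_ne_zero (hA.traj_mem hX k) i)).tendsto.comp (hrow X hX)
    exact ((hA.1 i).1.comp hdir fun X hX =>
      euclNorm_inv_smul_self (hA.mul_row_ne_zero (hA.traj_mem hX k) i)).smul hdir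

/-- Circular cones are forward invariant. -/
theorem Assumption2.cone_invariant (hA : Assumption2 A γbar) {X : Matrix (Fin n) (Fin d) ℝ}
    (hX : X ∈ Sset n d γbar) {w : Fin d → ℝ} {c : ℝ} (hc : 0 ≤ c) {s : ℕ}
    (hs : ∀ i, c * euclNorm (traj A γbar X s i) ≤ traj A γbar X s i ⬝ᵥ w) {k : ℕ} (hk : s ≤ k) :
    ∀ i, c * euclNorm (traj A γbar X k i) ≤ traj A γbar X k i ⬝ᵥ w := by
  induction k, hk using Nat.le_induction with
  | base => exact hs
  | succ k _ ih =>
    intro i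
    have hp := hA.stepScale_pos hX k i
    rw [traj_succ_row, euclNorm_smul, abs_of_pos hp, smul_dotProduct, smul_eq_mul,
      mul_left_comm, sum_dotProduct]
    refine mul_le_mul_of_nonneg_left ?_ hp.le
    refine (mul_le_mul_of_nonneg_left (euclNorm_sum_le _ _) hc).trans ?_
    rw [Finset.mul_sum]
    refine Finset.sum_le_sum fun j _ => ?_
    rw [euclNorm_smul, abs_of_nonneg (hA.nonneg i j), smul_dotProduct, smul_eq_mul, mul_left_comm]
    exact mul_le_mul_of_nonneg_left (ih j) (hA.nonneg i j)

/-- If the states eventually enter an open half-space, the entries of the product matrices are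
dominated by the heights of the states over the bounding hyperplane. -/
theorem Assumption2.Atilde_le_height (hA : Assumption2 A γbar) {X : Matrix (Fin n) (Fin d) ℝ}
    (hX : X ∈ Sset n d γbar) {w : Fin d → ℝ} {s : ℕ}
    (hs : ∀ i, 0 < traj A γbar X s i ⬝ᵥ w) :
    ∃ C : ℝ, ∀ k ≥ s, ∀ i j, Atilde A γbar X k i j ≤ C * (traj A γbar X k i ⬝ᵥ w) := by
  obtain ⟨C, hC⟩ := (Set.finite_range fun p : Fin n × Fin n =>
    Atilde A γbar X s p.1 p.2 / (traj A γbar X s p.1 ⬝ᵥ w)).bddAbove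
  refine ⟨C, fun k hk => ?_⟩
  induction k, hk using Nat.le_induction with
  | base =>
    intro i j
    exact (div_le_iff₀ (hs i)).1 (hC ⟨(i, j), rfl⟩)
  | succ k _ ih =>
    intro i j
    have hp := hA.stepScale_pos hX k i
    rw [Atilde_succ_apply, traj_succ_row, smul_dotProduct, smul_eq_mul, mul_left_comm,
      sum_dotProduct, Finset.mul_sum (a := C)]
    refine mul_le_mul_of_nonneg_left (Finset.sum_le_sum fun l _ => ?_) hp.le
    rw [smul_dotProduct, smul_eq_mul, mul_left_comm]
    exact mul_le_mul_of_nonneg_left (ih l j) (hA.nonneg i l)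

theorem Assumption2.euclNorm_Atilde_pos (hA : Assumption2 A γbar)
    {X : Matrix (Fin n) (Fin d) ℝ} (hX : X ∈ Sset n d γbar) (k : ℕ) (i : Fin n) :
    0 < euclNorm (Atilde A γbar X k i) := by
  rw [euclNorm_pos]
  intro h0
  apply hA.traj_ne_zero hX k i
  rw [traj_eq_Atilde_mul, mul_row_eq_vecMul, h0, Matrix.zero_vecMul]

theorem IsLimitVec.tendsto_scaled_traj {X : Matrix (Fin n) (Fin d) ℝ} {v : Fin n → ℝ}
    (hv : IsLimitVec A γbar X v) (i : Fin n) :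
    Tendsto (fun k => (euclNorm (Atilde A γbar X k i))⁻¹ • traj A γbar X k i) atTop
      (𝓝 (Matrix.vecMul v X)) := by
  have hcont : Continuous fun w : Fin n → ℝ => Matrix.vecMul w X :=
    continuous_id.matrix_vecMul continuous_const
  refine ((hcont.tendsto v).comp (hv.2.2 i)).congr fun k => ?_
  simp only [Function.comp_apply]
  rw [traj_eq_Atilde_mul, mul_row_eq_vecMul, Matrix.smul_vecMul]

/-- Under point-wise convergence of directions, the limiting weights do not annihilate the
initial state. -/
theorem Assumption2.vecMul_ne_zero (hA : Assumption2 A γbar) (i : Fin n)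
    {X : Matrix (Fin n) (Fin d) ℝ} (hX : X ∈ Sset n d γbar) (hpw : ConsensusPW (traj A γbar X))
    {v : Fin n → ℝ} (hv : IsLimitVec A γbar X v) : Matrix.vecMul v X ≠ 0 := by
  obtain ⟨u, hu, hlim⟩ := hpw
  have hcont : Continuous fun x : Fin d → ℝ => x ⬝ᵥ u :=
    continuous_id.dotProduct continuous_const
  have hev : ∀ᶠ t in atTop, ∀ j, 0 < traj A γbar X t j ⬝ᵥ u := by
    refine eventually_all.2 fun j => ?_
    have h1 := (hcont.tendsto u).comp (hlim j)
    rw [dotProduct_self_eq_euclNorm_sq, hu, one_pow] at h1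
    filter_upwards [h1.eventually_const_lt zero_lt_one] with t ht
    rw [Function.comp_apply, smul_dotProduct, smul_eq_mul] at ht
    exact pos_of_mul_pos_right ht (inv_nonneg.2 (euclNorm_nonneg _))
  obtain ⟨s, hs⟩ := hev.exists
  obtain ⟨C, hC⟩ := hA.Atilde_le_height hX hs
  intro h0
  have h1 := (((hcont.tendsto _).comp (hv.tendsto_scaled_traj i)).const_mul C)
  have h2 := ((continuous_apply i).tendsto v).comp (hv.2.2 i)
  rw [h0, zero_dotProduct, mul_zero] at h1
  refine (hv.2.1 i).not_ge (le_of_tendsto_of_tendsto h2 h1 ?_)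
  filter_upwards [eventually_ge_atTop s] with k hk
  simp only [Function.comp_apply, smul_dotProduct, smul_eq_mul, Pi.smul_apply]
  rw [mul_left_comm]
  exact mul_le_mul_of_nonneg_left (hC k hk i i) (inv_nonneg.2 (euclNorm_nonneg _))

theorem Assumption2.tendsto_direction (hA : Assumption2 A γbar)
    {X : Matrix (Fin n) (Fin d) ℝ} (hX : X ∈ Sset n d γbar) (hpw : ConsensusPW (traj A γbar X))
    {v : Fin n → ℝ} (hv : IsLimitVec A γbar X v) (i : Fin n) :
    Tendsto (fun t => (euclNorm (traj A γbar X t i))⁻¹ • traj A γbar X t i) atTop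
      (𝓝 ((euclNorm (Matrix.vecMul v X))⁻¹ • Matrix.vecMul v X)) := by
  refine ((continuousAt_euclNorm_inv_smul (hA.vecMul_ne_zero i hX hpw hv)).tendsto.comp
    (hv.tendsto_scaled_traj i)).congr fun k => ?_
  exact euclNorm_inv_smul_smul (inv_pos.2 (hA.euclNorm_Atilde_pos hX k i)) _

end Dynamics

theorem stmt15 {n d : ℕ} (hn : 1 ≤ n) (hd : 1 ≤ d)
    (A : Matrix (Fin n) (Fin n) ℝ) (γbar : Fin n → (Fin d → ℝ) → ℝ)
    (hA : Assumption2 A γbar)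
    (v : Matrix (Fin n) (Fin d) ℝ → Fin n → ℝ)
    (hv : ∀ X₀ ∈ Sset n d γbar, IsLimitVec A γbar X₀ (v X₀)) :
    (∀ X₀ ∈ {X₀ | X₀ ∈ Sset n d γbar ∧ ConsensusDir (traj A γbar X₀) ∧
        ConsensusPW (traj A γbar X₀)},
      ∀ i, Tendsto (fun t => (euclNorm (traj A γbar X₀ t i))⁻¹ • traj A γbar X₀ t i)
        atTop (𝓝 ((euclNorm (Matrix.vecMul (v X₀) X₀))⁻¹ • Matrix.vecMul (v X₀) X₀))) ∧
    ContinuousOn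
      (fun X₀ => (euclNorm (Matrix.vecMul (v X₀) X₀))⁻¹ • Matrix.vecMul (v X₀) X₀)
      {X₀ | X₀ ∈ Sset n d γbar ∧ ConsensusDir (traj A γbar X₀) ∧
        ConsensusPW (traj A γbar X₀)} := by
  have hlim : ∀ X ∈ {X₀ | X₀ ∈ Sset n d γbar ∧ ConsensusDir (traj A γbar X₀) ∧
      ConsensusPW (traj A γbar X₀)}, ∀ i,
      Tendsto (fun t => (euclNorm (traj A γbar X t i))⁻¹ • traj A γbar X t i) atTop
        (𝓝 ((euclNorm (Matrix.vecMul (v X) X))⁻¹ • Matrix.vecMul (v X) X)) :=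
    fun X hX => hA.tendsto_direction hX.1 hX.2.2 (hv X hX.1)
  refine ⟨hlim, fun Y hY => ?_⟩
  have hunit : ∀ X ∈ {X₀ | X₀ ∈ Sset n d γbar ∧ ConsensusDir (traj A γbar X₀) ∧
      ConsensusPW (traj A γbar X₀)},
      euclNorm ((euclNorm (Matrix.vecMul (v X) X))⁻¹ • Matrix.vecMul (v X) X) = 1 :=
    fun X hX => euclNorm_inv_smul_self (hA.vecMul_ne_zero ⟨0, hn⟩ hX.1 hX.2.2 (hv X hX.1))
  set u := (euclNorm (Matrix.vecMul (v Y) Y))⁻¹ • Matrix.vecMul (v Y) Y with hu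
  have hcont : Continuous fun x : Fin d → ℝ => x ⬝ᵥ u :=
    continuous_id.dotProduct continuous_const
  refine tendsto_of_tendsto_dotProduct_one (hunit Y hY)
    (eventually_nhdsWithin_of_forall hunit) fun c hc => ?_
  have hc' : max c 0 < 1 := max_lt hc one_pos
  have hev : ∀ᶠ t in atTop, ∀ j,
      max c 0 < ((euclNorm (traj A γbar Y t j))⁻¹ • traj A γbar Y t j) ⬝ᵥ u := by
    refine eventually_all.2 fun j => ?_
    have h1 := (hcont.tendsto u).comp (hlim Y hY j)
    rw [dotProduct_self_eq_euclNorm_sq, hunit Y hY, one_pow] at h1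
    exact h1.eventually_const_lt hc'
  obtain ⟨s, hs⟩ := hev.exists
  have hnear : ∀ᶠ X in 𝓝[Sset n d γbar] Y, ∀ j,
      max c 0 < ((euclNorm (traj A γbar X s j))⁻¹ • traj A γbar X s j) ⬝ᵥ u := by
    refine eventually_all.2 fun j => ?_
    have h1 : ContinuousWithinAt (fun X => traj A γbar X s j) (Sset n d γbar) Y :=
      (continuous_apply j).continuousAt.comp_continuousWithinAt (hA.continuousOn_traj s Y hY.1)
    have h2 := (hcont.tendsto _).comp
      ((continuousAt_euclNorm_inv_smul (hA.traj_ne_zero hY.1 s j)).tendsto.comp h1)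
    exact h2.eventually_const_lt (hs j)
  filter_upwards [hnear.filter_mono (nhdsWithin_mono Y fun X hX => hX.1), self_mem_nhdsWithin]
    with X hXs hX
  have hcone : ∀ j, max c 0 * euclNorm (traj A γbar X s j) ≤ traj A γbar X s j ⬝ᵥ u := by
    intro j
    have h1 := hXs j
    rw [smul_dotProduct, smul_eq_mul,
      lt_inv_mul_iff₀' (euclNorm_pos.2 (hA.traj_ne_zero hX.1 s j))] at h1
    exact h1.le
  refine (le_max_left c 0).trans
    (ge_of_tendsto ((hcont.tendsto _).comp (hlim X hX ⟨0, hn⟩)) ?_)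
  filter_upwards [eventually_ge_atTop s] with k hk
  rw [Function.comp_apply, smul_dotProduct, smul_eq_mul,
    le_inv_mul_iff₀' (euclNorm_pos.2 (hA.traj_ne_zero hX.1 k _))]
  exact hA.cone_invariant hX.1 (le_max_right c 0) hcone hk _
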